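/- arXiv:2106.01930 — 2 statements merged into one kernel-verified Lean document; each statement's English description precedes it below -/
import Mathlib

section
/- One has ρ(T) ≤ 0 and −ρ(T) = inradius(Col(V)). Moreover, if ρ(T) is finite, then there exists a ∈ R^n with T(a) ≤ ρ(T) + a, and for any such a the ball B(−a, −ρ(T)) is a Hilbert ball of maximal radius contained in Col(V). -/
open scoped Classical BigOperators

noncomputable section

namespace TropReg

/-- `x` is a vector of `Rmax = ℝ ∪ {-∞}`, modeled inside `EReal` as having no `+∞` entry. -/
def IsRmax {n : ℕ} (x : Fin n → EReal) : Prop := ∀ i, x i ≠ ⊤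

/-- Embedding of a real vector into `(Rmax)^n`. -/
def ofReal {n : ℕ} (a : Fin n → ℝ) : Fin n → EReal := fun i => (a i : EReal)

/-- Hilbert's projective metric on `(Rmax)^n`, with values in `[0,+∞] ⊆ EReal`;
`d(⊥,⊥) = 0` by convention, and the infimum of the empty set is `+∞`. -/
def hd {n : ℕ} (x y : Fin n → EReal) : EReal :=
  if x = ⊥ ∧ y = ⊥ then 0
  else sInf { t : EReal | ∃ lam mu : ℝ, t = (lam : EReal) - (mu : EReal) ∧
        (∀ i, (mu : EReal) + y i ≤ x i) ∧ (∀ i, x i ≤ (lam : EReal) + y i) }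

/-- Closed Hilbert ball of center `a` and radius `r`, inside `(Rmax)^n`. -/
def ball {n : ℕ} (a : Fin n → EReal) (r : EReal) : Set (Fin n → EReal) :=
  { x | IsRmax x ∧ hd a x ≤ r }

/-- Hilbert distance from a point to a set. -/
def distPt {n : ℕ} (x : Fin n → EReal) (B : Set (Fin n → EReal)) : EReal :=
  ⨅ b ∈ B, hd x b

/-- One-sided Hausdorff distance from `A` to `B` for Hilbert's metric. -/
def distHS {n : ℕ} (A B : Set (Fin n → EReal)) : EReal :=
  ⨆ a ∈ A, distPt a B

/-- Tropical hyperplane associated with `a`: the maximum `max_i (a_i + x_i)` is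
attained at least twice. -/
def hyper {n : ℕ} (a : Fin n → EReal) : Set (Fin n → EReal) :=
  { x | IsRmax x ∧ ∃ i j : Fin n, i ≠ j ∧
      a i + x i = (⨆ k, a k + x k) ∧ a j + x j = (⨆ k, a k + x k) }

/-- Tropical column space of the matrix `V`. -/
def colSpace {n p : ℕ} (V : Fin n → Fin p → EReal) : Set (Fin n → EReal) :=
  { y | ∃ x : Fin p → EReal, IsRmax x ∧ y = fun i => ⨆ k, (V i k + x k) }

/-- The `k`-th column of `V`. -/
def col {n p : ℕ} (V : Fin n → Fin p → EReal) (k : Fin p) : Fin n → EReal :=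
  fun i => V i k

/-- The set of columns of `V`. -/
def cols {n p : ℕ} (V : Fin n → Fin p → EReal) : Set (Fin n → EReal) :=
  Set.range (col V)

/-- The Shapley operator associated with the matrix `V`. -/
def TV {n p : ℕ} (V : Fin n → Fin p → EReal) (x : Fin n → EReal) : Fin n → EReal :=
  fun i => ⨅ k ∈ { k : Fin p | V i k ≠ ⊥ },
    (-(V i k) + ⨆ j ∈ { j : Fin n | j ≠ i }, (V j k + x j))

/-- Tropical spectral radius of an operator `T`. -/
def rho {n : ℕ} (T : (Fin n → EReal) → (Fin n → EReal)) : EReal :=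
  sSup { lam : EReal | lam ≠ ⊤ ∧ ∃ u : Fin n → EReal, IsRmax u ∧ u ≠ ⊥ ∧
      T u = fun i => lam + u i }

/-- Tropical convex cone in `(Rmax)^n`. -/
def IsTropCone {n : ℕ} (C : Set (Fin n → EReal)) : Prop :=
  (∀ x ∈ C, ∀ y ∈ C, (fun i => x i ⊔ y i) ∈ C) ∧
  (∀ x ∈ C, ∀ lam : EReal, lam ≠ ⊤ → (fun i => lam + x i) ∈ C)

/-- Tropical span: smallest tropical cone containing `Vs`. -/
def span {n : ℕ} (Vs : Set (Fin n → EReal)) : Set (Fin n → EReal) :=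
  ⋂₀ { C | IsTropCone C ∧ Vs ⊆ C }

/-- Inner radius: supremum of radii of Hilbert balls centered at finite points
included in `W`. -/
def inradius {n : ℕ} (W : Set (Fin n → EReal)) : EReal :=
  sSup { r : EReal | ∃ s : ℝ, r = (s : EReal) ∧ 0 ≤ s ∧
      ∃ a : Fin n → ℝ, ball (ofReal a) r ⊆ W }

/-! ### Order-theoretic description of the Shapley operator -/

lemma neg_coe_add_le_iff (v : ℝ) (y c : EReal) :
    -(v : EReal) + y ≤ c ↔ y ≤ (v : EReal) + c := by
  rw [add_comm, ← sub_eq_add_neg, add_comm (v : EReal) c]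
  exact EReal.sub_le_iff_le_add (Or.inl (EReal.coe_ne_bot v)) (Or.inl (EReal.coe_ne_top v))

lemma le_neg_coe_add_iff (v : ℝ) (y c : EReal) :
    c ≤ -(v : EReal) + y ↔ (v : EReal) + c ≤ y := by
  rw [add_comm, ← sub_eq_add_neg, add_comm (v : EReal) c]
  exact EReal.le_sub_iff_add_le (Or.inl (EReal.coe_ne_bot v)) (Or.inl (EReal.coe_ne_top v))

section Shapley

variable {n p : ℕ} {V : Fin n → Fin p → EReal}

lemma TV_le_iff (hVtop : ∀ i k, V i k ≠ ⊤) (hrow : ∀ i, ∃ k, V i k ≠ ⊥)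
    (x : Fin n → EReal) (i : Fin n) (c : EReal) :
    TV V x i ≤ c ↔ ∃ k, V i k ≠ ⊥ ∧ ∀ j, j ≠ i → V j k + x j ≤ V i k + c := by
  have key : ∀ k, V i k ≠ ⊥ →
      (-(V i k) + (⨆ j ∈ { j : Fin n | j ≠ i }, (V j k + x j)) ≤ c ↔
        ∀ j, j ≠ i → V j k + x j ≤ V i k + c) := by
    intro k hk
    lift V i k to ℝ using ⟨hVtop i k, hk⟩ with v
    rw [neg_coe_add_le_iff, iSup₂_le_iff]
    rfl
  constructor
  · intro h
    obtain ⟨k₀, hk₀⟩ := hrow i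
    have : Nonempty { k : Fin p | V i k ≠ ⊥ } := ⟨⟨k₀, hk₀⟩⟩
    rw [TV, iInf_subtype'] at h
    obtain ⟨⟨k, hk⟩, hke⟩ := exists_eq_ciInf_of_finite
      (f := fun k : { k : Fin p | V i k ≠ ⊥ } =>
        -(V i k) + ⨆ j ∈ { j : Fin n | j ≠ i }, (V j k + x j))
    exact ⟨k, hk, (key k hk).1 (hke.trans_le h)⟩
  · rintro ⟨k, hk, hj⟩
    exact (iInf₂_le k hk).trans ((key k hk).2 hj)

lemma le_TV_iff (hVtop : ∀ i k, V i k ≠ ⊤)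
    (x : Fin n → EReal) (i : Fin n) {c : EReal} (hc : c ≠ ⊥) :
    c ≤ TV V x i ↔ ∀ k, V i k ≠ ⊥ → ∃ j, j ≠ i ∧ V i k + c ≤ V j k + x j := by
  rw [TV, le_iInf₂_iff]
  refine forall_congr' fun k => forall_congr' fun hk => ?_
  change V i k ≠ ⊥ at hk
  lift V i k to ℝ using ⟨hVtop i k, hk⟩ with v
  rw [le_neg_coe_add_iff]
  constructor
  · intro h
    rw [iSup_subtype'] at h
    rcases isEmpty_or_nonempty { j : Fin n | j ≠ i } with he | he
    · rw [iSup_of_empty, le_bot_iff, EReal.add_eq_bot_iff] at h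
      simp [hc] at h
    · obtain ⟨⟨j, hj⟩, hje⟩ := exists_eq_ciSup_of_finite
        (f := fun j : { j : Fin n | j ≠ i } => V j k + x j)
      exact ⟨j, hj, h.trans hje.ge⟩
  · rintro ⟨j, hj, h⟩
    exact h.trans (le_iSup₂ (f := fun j (_ : j ∈ { j : Fin n | j ≠ i }) => V j k + x j) j hj)

lemma TV_mono : Monotone (TV V) := fun _ _ h _ =>
  iInf₂_mono fun _ _ => add_le_add le_rfl <| iSup₂_mono fun j _ => add_le_add le_rfl (h j)

lemma TV_add_const (hVtop : ∀ i k, V i k ≠ ⊤) (hrow : ∀ i, ∃ k, V i k ≠ ⊥)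
    (r : ℝ) (x : Fin n → EReal) (i : Fin n) :
    TV V (fun j => (r : EReal) + x j) i = (r : EReal) + TV V x i := by
  refine eq_of_forall_ge_iff fun c => ?_
  have hr := neg_coe_add_le_iff (-r)
  have hr' := neg_coe_add_le_iff r
  simp only [EReal.coe_neg, neg_neg] at hr
  rw [hr, TV_le_iff hVtop hrow, TV_le_iff hVtop hrow]
  refine exists_congr fun k => and_congr_right fun _ => forall_congr' fun j =>
    imp_congr_right fun _ => ?_
  rw [add_left_comm, hr, add_left_comm]

/-- A real super-eigenvector bounds every eigenvalue from above. -/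
lemma eigenvalue_le (hVtop : ∀ i k, V i k ≠ ⊤) (hrow : ∀ i, ∃ k, V i k ≠ ⊥)
    {μ : ℝ} {a : Fin n → ℝ} (ha : ∀ i, TV V (ofReal a) i ≤ (μ : EReal) + (a i : EReal))
    {lam : EReal} {u : Fin n → EReal} (hu : IsRmax u) (hu0 : u ≠ ⊥)
    (hT : TV V u = fun i => lam + u i) : lam ≤ μ := by
  obtain ⟨i₀, hi₀⟩ : ∃ i, u i ≠ ⊥ := by
    by_contra! h
    exact hu0 (funext h)
  have : Nonempty (Fin n) := ⟨i₀⟩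
  obtain ⟨i, hi⟩ := Finite.exists_max fun j => -(a j : EReal) + u j
  have hbot : u i ≠ ⊥ := by
    intro h
    have := hi i₀
    rw [h, EReal.add_bot, le_bot_iff, EReal.add_eq_bot_iff] at this
    rcases this with h' | h'
    · rw [← EReal.coe_neg] at h'
      exact EReal.coe_ne_bot _ h'
    · exact hi₀ h'
  obtain ⟨k, hk, hj⟩ := (TV_le_iff hVtop hrow _ _ _).1 (ha i)
  have hle : TV V u i ≤ (μ : EReal) + u i := by
    refine (TV_le_iff hVtop hrow _ _ _).2 ⟨k, hk, fun j hji => ?_⟩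
    have h1 := (neg_coe_add_le_iff _ _ _).1 (hi j)
    have h2 := hj j hji
    simp only [ofReal] at h2
    calc V j k + u j ≤ V j k + ((a j : EReal) + (-(a i : EReal) + u i)) := by gcongr
      _ = (V j k + a j) + (-(a i : EReal) + u i) := (add_assoc _ _ _).symm
      _ ≤ (V i k + (μ + a i)) + (-(a i : EReal) + u i) := by gcongr
      _ = (V i k + (μ + u i)) + ((a i : EReal) + -(a i : EReal)) := by ac_rfl
      _ = V i k + (μ + u i) := by
        rw [← EReal.coe_neg, ← EReal.coe_add, add_neg_cancel, EReal.coe_zero, add_zero]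
  rw [hT] at hle
  lift u i to ℝ using ⟨hu i, hbot⟩ with w
  exact (EReal.addLECancellable_coe w).add_le_add_iff_right.1 hle

/-- If no real super-eigenvector exists at level `μ`, then for each depth `C` there is a normalized
vector which is sub-invariant at level `μ` up to the threshold `-C`. -/
lemma exists_truncated_sub (hVtop : ∀ i k, V i k ≠ ⊤) (hrow : ∀ i, ∃ k, V i k ≠ ⊥)
    {μ : ℝ} (hμ : ¬ ∃ a : Fin n → ℝ, ∀ i, TV V (ofReal a) i ≤ (μ : EReal) + (a i : EReal))
    {C : ℝ} (hC : 0 ≤ C) :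
    ∃ u : Fin n → EReal, (∀ i, u i ≤ 0) ∧ (∃ i, u i = 0) ∧
      ∀ i, u i ≤ max (-(C : EReal)) (-(μ : EReal) + TV V u i) := by
  let F : (Fin n → EReal) →o (Fin n → EReal) :=
    ⟨fun b i => min (C : EReal) (max 0 (-(μ : EReal) + TV V b i)), fun _ _ h i =>
      min_le_min le_rfl (max_le_max le_rfl (add_le_add le_rfl (TV_mono h i)))⟩
  obtain ⟨b, hb⟩ : ∃ b, F b = b := ⟨F.lfp, F.map_lfp⟩
  have hbi : ∀ i, b i = min (C : EReal) (max 0 (-(μ : EReal) + TV V b i)) :=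
    fun i => (congrFun hb i).symm
  have hC' : (0 : EReal) ≤ C := by exact_mod_cast hC
  have hb0 : ∀ i, 0 ≤ b i := fun i => by rw [hbi]; exact le_min hC' (le_max_left _ _)
  have hbC : ∀ i, b i ≤ C := fun i => by rw [hbi]; exact min_le_left _ _
  have hex : ∃ i, b i = C := by
    by_contra! hne
    refine hμ ⟨fun i => (b i).toReal, fun i => ?_⟩
    have hreal : ∀ i, ((b i).toReal : EReal) = b i := fun i =>
      EReal.coe_toReal ((hbC i).trans_lt (EReal.coe_lt_top C)).ne
        (EReal.bot_lt_zero.trans_le (hb0 i)).ne'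
    have hb' : ofReal (fun i => (b i).toReal) = b := funext hreal
    rw [hb', hreal, ← neg_coe_add_le_iff]
    have := hbi i
    rcases min_choice (C : EReal) (max 0 (-(μ : EReal) + TV V b i)) with h | h
    · exact absurd (this.trans h) (hne i)
    · rw [this.trans h]
      exact le_max_right _ _
  have hcancel : -(C : EReal) + C = 0 := by
    rw [← EReal.coe_neg, ← EReal.coe_add, neg_add_cancel, EReal.coe_zero]
  refine ⟨fun i => ((-C : ℝ) : EReal) + b i, fun i => ?_, ?_, fun i => ?_⟩
  · rw [EReal.coe_neg, neg_coe_add_le_iff, add_zero]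
    exact hbC i
  · obtain ⟨i, hi⟩ := hex
    exact ⟨i, by simp only [hi, EReal.coe_neg, hcancel]⟩
  · rw [TV_add_const hVtop hrow, EReal.coe_neg, neg_coe_add_le_iff]
    refine (hbi i).trans_le ((min_le_right _ _).trans (max_le ?_ ?_))
    · rw [← neg_coe_add_le_iff, add_zero]
      exact le_max_left _ _
    · rw [← neg_coe_add_le_iff]
      refine le_trans (le_of_eq ?_) (le_max_right _ _)
      ac_rfl

/-- If no real super-eigenvector exists strictly below level `lam`, then there is a sub-eigenvector
at level `lam`. -/
lemma exists_sub_eigenvector (hVtop : ∀ i k, V i k ≠ ⊤) (hrow : ∀ i, ∃ k, V i k ≠ ⊥)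
    {lam : ℝ} (hlam : ∀ μ : ℝ, μ < lam →
      ¬ ∃ a : Fin n → ℝ, ∀ i, TV V (ofReal a) i ≤ (μ : EReal) + (a i : EReal)) :
    ∃ u : Fin n → EReal, IsRmax u ∧ u ≠ ⊥ ∧ ∀ i, (lam : EReal) + u i ≤ TV V u i := by
  have hstep : ∀ m : ℕ, lam - 1 / ((m : ℝ) + 1) < lam := fun m => by
    have : 0 < 1 / ((m : ℝ) + 1) := by positivity
    linarith
  choose U hU0 hUz hU using fun m : ℕ =>
    exists_truncated_sub hVtop hrow (hlam _ (hstep m)) (Nat.cast_nonneg (α := ℝ) m)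
  let G : Ultrafilter ℕ := Filter.hyperfilter ℕ
  have hG : (G : Filter ℕ) ≤ Filter.atTop := Nat.hyperfilter_le_atTop
  have hlim : ∀ i, ∃ w : EReal, Filter.Tendsto (fun m => U m i) G (nhds w) := fun i =>
    ⟨(G.map fun m => U m i).lim, (G.map fun m => U m i).le_nhds_lim⟩
  choose u hu using hlim
  have hu0 : ∀ i, u i ≤ 0 := fun i =>
    le_of_tendsto (hu i) (Filter.Eventually.of_forall fun m => hU0 m i)
  have hutop : IsRmax u := fun i => ((hu0 i).trans_lt EReal.zero_lt_top).ne
  refine ⟨u, hutop, ?_, fun i => ?_⟩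
  · obtain ⟨i, hi⟩ := (Ultrafilter.eventually_exists_iff (f := G)).1
      (Filter.Eventually.of_forall hUz)
    have : u i = 0 := tendsto_nhds_unique (hu i)
      (tendsto_const_nhds.congr' (hi.mono fun m hm => hm.symm))
    intro hbot
    rw [hbot] at this
    exact EReal.bot_ne_zero this
  · rcases eq_or_ne (u i) ⊥ with hib | hib
    · rw [hib, EReal.add_bot]
      exact bot_le
    have hne : (lam : EReal) + u i ≠ ⊥ := by
      rw [EReal.add_ne_bot_iff]
      exact ⟨EReal.coe_ne_bot _, hib⟩
    rw [le_TV_iff hVtop _ _ hne]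
    intro k hk
    obtain ⟨r, hr, hru⟩ := EReal.lt_iff_exists_real_btwn.1 (bot_lt_iff_ne_bot.2 hib)
    have hev : ∀ᶠ m : ℕ in (G : Filter ℕ), ∃ j, j ≠ i ∧
        V i k + (((lam - 1 / ((m : ℝ) + 1) : ℝ) : EReal) + U m i) ≤ V j k + U m j := by
      have h1 : ∀ᶠ m in (G : Filter ℕ), (r : EReal) < U m i := (hu i).eventually_const_lt hru
      have h2 : ∀ᶠ m : ℕ in (G : Filter ℕ), -r ≤ (m : ℝ) :=
        hG (tendsto_natCast_atTop_atTop.eventually_ge_atTop (-r))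
      filter_upwards [h1, h2] with m hm1 hm2
      have hlt : -((m : ℝ) : EReal) < U m i := by
        refine lt_of_le_of_lt ?_ hm1
        rw [← EReal.coe_neg, EReal.coe_le_coe_iff]
        linarith
      have hle := (le_max_iff.1 (hU m i)).resolve_left hlt.not_ge
      rw [le_neg_coe_add_iff] at hle
      refine (le_TV_iff hVtop _ _ ?_).1 hle k hk
      rw [EReal.add_ne_bot_iff]
      exact ⟨EReal.coe_ne_bot _, (bot_lt_iff_ne_bot.1 ((EReal.bot_lt_coe r).trans hm1))⟩
    obtain ⟨j, hj⟩ := Ultrafilter.eventually_exists_iff.1 hev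
    obtain ⟨_, hji, -⟩ := hj.exists
    have hlamT : Filter.Tendsto (fun m : ℕ => ((lam - 1 / ((m : ℝ) + 1) : ℝ) : EReal)) G
        (nhds (lam : EReal)) := by
      refine (continuous_coe_real_ereal.tendsto lam).comp (Filter.Tendsto.mono_left ?_ hG)
      simpa using (tendsto_const_nhds (x := lam)).sub
        (tendsto_one_div_add_atTop_nhds_zero_nat (𝕜 := ℝ))
    have hadd : ∀ {f g : ℕ → EReal} {x y : EReal}, Filter.Tendsto f G (nhds x) →
        Filter.Tendsto g G (nhds y) → x ≠ ⊤ → y ≠ ⊤ →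
        Filter.Tendsto (fun m => f m + g m) G (nhds (x + y)) := fun hf hg hx hy =>
      (EReal.continuousAt_add (p := (_, _)) (Or.inl hx) (Or.inr hy)).tendsto.comp
        (hf.prodMk_nhds hg)
    refine ⟨j, hji, le_of_tendsto_of_tendsto
      (hadd tendsto_const_nhds (hadd hlamT (hu i) (EReal.coe_ne_top _) (hutop i)) (hVtop i k)
        (EReal.add_ne_top (EReal.coe_ne_top _) (hutop i)))
      (hadd tendsto_const_nhds (hu j) (hVtop j k) (hutop j)) (hj.mono fun m hm => hm.2)⟩

/-- Between a sub-eigenvector and a real super-eigenvector at the same level there is an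
eigenvector. -/
lemma exists_eigenvector (hVtop : ∀ i k, V i k ≠ ⊤) (hrow : ∀ i, ∃ k, V i k ≠ ⊥)
    {lam : ℝ} {a : Fin n → ℝ}
    (ha : ∀ i, TV V (ofReal a) i ≤ (lam : EReal) + (a i : EReal))
    {u : Fin n → EReal} (hu : IsRmax u) (hu0 : u ≠ ⊥)
    (hsub : ∀ i, (lam : EReal) + u i ≤ TV V u i) :
    ∃ v : Fin n → EReal, IsRmax v ∧ v ≠ ⊥ ∧ TV V v = fun i => (lam : EReal) + v i := by
  obtain ⟨c, hc⟩ : ∃ c : ℝ, ∀ i, u i ≤ (c : EReal) + a i := by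
    obtain ⟨c, hc⟩ := (Set.finite_range fun i => (u i).toReal - a i).bddAbove
    refine ⟨c, fun i => (EReal.le_coe_toReal (hu i)).trans ?_⟩
    have := hc ⟨i, rfl⟩
    simp only at this
    rw [← EReal.coe_add, EReal.coe_le_coe_iff]
    linarith
  let F : (Fin n → EReal) →o (Fin n → EReal) :=
    ⟨fun b i => min ((c : EReal) + a i) (-(lam : EReal) + TV V b i), fun _ _ h i =>
      min_le_min le_rfl (add_le_add le_rfl (TV_mono h i))⟩
  obtain ⟨v, hv⟩ : ∃ v, F v = v ∧ u ≤ v := by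
    refine ⟨F.gfp, F.map_gfp, F.le_gfp fun i => le_min (hc i) ?_⟩
    rw [le_neg_coe_add_iff]
    exact hsub i
  have hvi : ∀ i, v i = min ((c : EReal) + a i) (-(lam : EReal) + TV V v i) :=
    fun i => (congrFun hv.1 i).symm
  have hva : ∀ i, v i ≤ (c : EReal) + a i := fun i => by
    rw [hvi]
    exact min_le_left _ _
  refine ⟨v, fun i h => ?_, fun h => hu0 (le_bot_iff.1 (h ▸ hv.2)), funext fun i => ?_⟩
  · have := hva i
    rw [h, ← EReal.coe_add] at this
    exact absurd this (not_le.2 (EReal.coe_lt_top _))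
  · apply le_antisymm
    · rw [← neg_coe_add_le_iff]
      refine le_of_le_of_eq (le_min ?_ le_rfl) (hvi i).symm
      rw [neg_coe_add_le_iff]
      calc TV V v i ≤ TV V (fun j => (c : EReal) + ofReal a j) i := TV_mono hva i
        _ = (c : EReal) + TV V (ofReal a) i := TV_add_const hVtop hrow c _ i
        _ ≤ (c : EReal) + (lam + a i) := by gcongr; exact ha i
        _ = lam + (c + a i) := add_left_comm _ _ _
    · rw [← le_neg_coe_add_iff]
      exact (hvi i).trans_le (min_le_right _ _)

end Shapley

/-! ### Potentials -/

/-- A finite system of difference constraints which is solvable up to every positive error is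
solvable. -/
lemma exists_potential {ι : Type*} (s : Finset ι) : ∀ B : ι → ι → EReal, (∀ i j, B i j ≠ ⊤) →
    (∀ ε : ℝ, 0 < ε → ∃ a : ι → ℝ, ∀ i ∈ s, ∀ j ∈ s,
      B i j + (a j : EReal) ≤ (ε : EReal) + (a i : EReal)) →
    ∃ a : ι → ℝ, ∀ i ∈ s, ∀ j ∈ s, B i j + (a j : EReal) ≤ (a i : EReal) := by
  induction s using Finset.induction_on with
  | empty => exact fun _ _ _ => ⟨0, by simp⟩
  | insert q s hq ih =>
    intro B hB h
    obtain ⟨a, ha⟩ := ih (fun i j => max (B i j) (B i q + B q j))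
      (fun i j => (max_lt (lt_top_iff_ne_top.2 (hB i j))
        (EReal.add_lt_top (hB i q) (hB q j))).ne) (by
        intro ε hε
        obtain ⟨a, ha⟩ := h (ε / 2) (half_pos hε)
        refine ⟨a, fun i hi j hj => ?_⟩
        have hij := ha i (Finset.mem_insert_of_mem hi) j (Finset.mem_insert_of_mem hj)
        have hiq := ha i (Finset.mem_insert_of_mem hi) q (Finset.mem_insert_self _ _)
        have hqj := ha q (Finset.mem_insert_self _ _) j (Finset.mem_insert_of_mem hj)
        rw [max_add]
        refine max_le (hij.trans ?_) ?_
        · norm_cast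
          linarith
        · calc B i q + B q j + a j = B i q + (B q j + a j) := add_assoc _ _ _
            _ ≤ B i q + (((ε / 2 : ℝ) : EReal) + a q) := by gcongr
            _ = ((ε / 2 : ℝ) : EReal) + (B i q + a q) := add_left_comm _ _ _
            _ ≤ ((ε / 2 : ℝ) : EReal) + (((ε / 2 : ℝ) : EReal) + a i) := by gcongr
            _ = (ε : EReal) + a i := by
              norm_cast
              ring)
    have hloop : B q q ≤ 0 := by
      refine EReal.le_of_forall_lt_iff_le.1 fun z hz => ?_
      have hz' : 0 < z := by exact_mod_cast hz
      obtain ⟨a, ha⟩ := h z hz'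
      exact (EReal.addLECancellable_coe (a q)).add_le_add_iff_right.1
        (ha q (Finset.mem_insert_self _ _) q (Finset.mem_insert_self _ _))
    obtain ⟨t, htl, htu⟩ : ∃ t : ℝ, (∀ j ∈ s, B q j + (a j : EReal) ≤ t) ∧
        ∀ i ∈ s, (t : EReal) ≤ (a i : EReal) - B i q := by
      have hlu : s.sup (fun j => B q j + (a j : EReal)) ≤ s.inf fun i => (a i : EReal) - B i q := by
        refine Finset.sup_le fun j hj => Finset.le_inf fun i hi => ?_
        rw [EReal.le_sub_iff_add_le (Or.inr (EReal.coe_ne_bot _)) (Or.inr (EReal.coe_ne_top _))]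
        refine le_trans (le_of_eq ?_) ((add_le_add (le_max_right _ _) le_rfl).trans (ha i hi j hj))
        ac_rfl
      have hl : s.sup (fun j => B q j + (a j : EReal)) < ⊤ :=
        (Finset.sup_lt_iff bot_lt_top).2 fun j _ => EReal.add_lt_top (hB q j) (EReal.coe_ne_top _)
      have hu : ⊥ < s.inf fun i => (a i : EReal) - B i q := by
        refine (Finset.lt_inf_iff bot_lt_top).2 fun i _ => ?_
        rw [sub_eq_add_neg, EReal.bot_lt_add_iff]
        exact ⟨EReal.bot_lt_coe _, bot_lt_iff_ne_bot.2 (by simpa using hB i q)⟩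
      obtain ⟨t, ht1, ht2⟩ : ∃ t : ℝ, s.sup (fun j => B q j + (a j : EReal)) ≤ t ∧
          (t : EReal) ≤ s.inf fun i => (a i : EReal) - B i q := by
        rcases eq_or_ne (s.sup fun j => B q j + (a j : EReal)) ⊥ with hb | hb
        · obtain ⟨t, -, ht⟩ := EReal.lt_iff_exists_real_btwn.1 hu
          exact ⟨t, hb ▸ bot_le, ht.le⟩
        · refine ⟨(s.sup fun j => B q j + (a j : EReal)).toReal, ?_, ?_⟩ <;>
            rw [EReal.coe_toReal hl.ne hb]
          exact hlu
      exact ⟨t, fun j hj => (Finset.le_sup (f := fun j => B q j + (a j : EReal)) hj).trans ht1,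
        fun i hi => ht2.trans (Finset.inf_le hi)⟩
    have hne : ∀ i ∈ s, i ≠ q := fun i hi h => hq (h ▸ hi)
    refine ⟨Function.update a q t, fun i hi j hj => ?_⟩
    rcases Finset.mem_insert.1 hi with rfl | hi' <;> rcases Finset.mem_insert.1 hj with rfl | hj'
    · calc _ ≤ (0 : EReal) + _ := add_le_add hloop le_rfl
        _ = _ := zero_add _
    · simpa [hne j hj'] using htl j hj'
    · have := htu i hi'
      rw [EReal.le_sub_iff_add_le (Or.inr (EReal.coe_ne_bot _))
        (Or.inr (EReal.coe_ne_top _)), add_comm] at this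
      simpa [hne i hi'] using this
    · have := (add_le_add (le_max_left _ _) le_rfl).trans (ha i hi' j hj')
      simpa [hne i hi', hne j hj'] using this

section Radius

variable {n p : ℕ} {V : Fin n → Fin p → EReal}

/-- The set of levels admitting a real super-eigenvector is closed from above. -/
lemma exists_super_of_forall_pos (hVtop : ∀ i k, V i k ≠ ⊤) (hrow : ∀ i, ∃ k, V i k ≠ ⊥)
    {lam : ℝ} (h : ∀ ε : ℝ, 0 < ε → ∃ a : Fin n → ℝ, ∀ i,
      TV V (ofReal a) i ≤ ((lam + ε : ℝ) : EReal) + (a i : EReal)) :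
    ∃ a : Fin n → ℝ, ∀ i, TV V (ofReal a) i ≤ (lam : EReal) + (a i : EReal) := by
  have policy : ∃ σ : Fin n → Fin p, (∀ i, V i (σ i) ≠ ⊥) ∧ ∀ ε : ℝ, 0 < ε →
      ∃ a : Fin n → ℝ, ∀ i j, j ≠ i →
        V j (σ i) + (a j : EReal) ≤ V i (σ i) + (((lam + ε : ℝ) : EReal) + (a i : EReal)) := by
    by_contra! hno
    have hσ : ∀ σ : Fin n → Fin p, ∃ ε : ℝ, 0 < ε ∧ ((∀ i, V i (σ i) ≠ ⊥) →
        ∀ a : Fin n → ℝ, ∃ i j, j ≠ i ∧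
          V i (σ i) + (((lam + ε : ℝ) : EReal) + (a i : EReal)) < V j (σ i) + (a j : EReal)) := by
      intro σ
      by_cases hs : ∀ i, V i (σ i) ≠ ⊥
      · obtain ⟨ε, hε, he⟩ := hno σ hs
        exact ⟨ε, hε, fun _ => he⟩
      · exact ⟨1, one_pos, fun h => absurd h hs⟩
    choose e he hbad using hσ
    obtain ⟨ε, hε, hle⟩ : ∃ ε : ℝ, 0 < ε ∧ ∀ σ, ε ≤ e σ := by
      rcases isEmpty_or_nonempty (Fin n → Fin p) with hE | hE
      · exact ⟨1, one_pos, fun σ => hE.elim σ⟩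
      · obtain ⟨σ, hσ⟩ := Finite.exists_min e
        exact ⟨e σ, he σ, hσ⟩
    obtain ⟨a, ha⟩ := h ε hε
    choose σ hσ hj using fun i => (TV_le_iff hVtop hrow _ _ _).1 (ha i)
    obtain ⟨i, j, hji, hlt⟩ := hbad σ hσ a
    refine hlt.not_ge ((hj i j hji).trans ?_)
    have : ((lam + ε : ℝ) : EReal) ≤ ((lam + e σ : ℝ) : EReal) := by
      have := hle σ
      rw [EReal.coe_le_coe_iff]
      linarith
    gcongr
  obtain ⟨σ, hσ, hε⟩ := policy
  choose v hv using fun i => (⟨_, EReal.coe_toReal (hVtop i (σ i)) (hσ i)⟩ :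
    ∃ v : ℝ, (v : EReal) = V i (σ i))
  have hcoe : ∀ (i j : Fin n) (y c : EReal),
      ((-(v i + lam) : ℝ) : EReal) + V j (σ i) + y ≤ c ↔ V j (σ i) + y ≤ V i (σ i) + (lam + c) := by
    intro i j y c
    rw [EReal.coe_neg, add_assoc, neg_coe_add_le_iff, EReal.coe_add, hv, add_assoc]
  obtain ⟨a, ha⟩ := exists_potential Finset.univ
    (fun i j => if j = i then ⊥ else ((-(v i + lam) : ℝ) : EReal) + V j (σ i))
    (fun i j => by
      split_ifs
      · exact bot_ne_top
      · exact EReal.add_ne_top (EReal.coe_ne_top _) (hVtop _ _))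
    (by
      intro ε hpos
      obtain ⟨a, ha⟩ := hε ε hpos
      refine ⟨a, fun i _ j _ => ?_⟩
      split_ifs with hij
      · rw [EReal.bot_add]
        exact bot_le
      · rw [hcoe, ← add_assoc (lam : EReal), ← EReal.coe_add]
        exact ha i j hij)
  refine ⟨a, fun i => (TV_le_iff hVtop hrow _ _ _).2 ⟨σ i, hσ i, fun j hji => ?_⟩⟩
  have := ha i (Finset.mem_univ _) j (Finset.mem_univ _)
  rw [if_neg hji, hcoe] at this
  exact this

/-! ### Hilbert balls in the column space -/

lemma ball_spread {b : Fin n → ℝ} {s : ℝ} {x : Fin n → EReal}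
    (hx : x ∈ ball (ofReal b) (s : EReal)) (i j : Fin n) :
    x i ≠ ⊥ ∧ (b i : EReal) + x j ≤ ((s + b j : ℝ) : EReal) + x i := by
  obtain ⟨hxt, hd'⟩ := hx
  have hnot : ¬ (ofReal b = ⊥ ∧ x = ⊥) := fun h => EReal.coe_ne_bot (b i) (congrFun h.1 i)
  rw [hd, if_neg hnot] at hd'
  have key : ∀ z : ℝ, s < z → x i ≠ ⊥ ∧ (b i : EReal) + x j ≤ ((z + b j : ℝ) : EReal) + x i := by
    intro z hz
    obtain ⟨_, ⟨l, m, rfl, hm, hl⟩, hlt⟩ :=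
      sInf_lt_iff.1 (hd'.trans_lt (EReal.coe_lt_coe_iff.2 hz))
    have hlm : l - m < z := by exact_mod_cast hlt
    have hli := hl i
    have hmj := hm j
    simp only [ofReal] at hli hmj
    have hbot : x i ≠ ⊥ := by
      intro h
      rw [h, EReal.add_bot, le_bot_iff] at hli
      exact EReal.coe_ne_bot _ hli
    refine ⟨hbot, ?_⟩
    lift x i to ℝ using ⟨hxt i, hbot⟩ with xi
    rcases eq_or_ne (x j) ⊥ with hj | hj
    · rw [hj, EReal.add_bot]
      exact bot_le
    lift x j to ℝ using ⟨hxt j, hj⟩ with xj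
    norm_cast at *
    linarith
  have hbot := (key (s + 1) (by linarith)).1
  refine ⟨hbot, ?_⟩
  rcases eq_or_ne (x j) ⊥ with hj | hj
  · rw [hj, EReal.add_bot]
    exact bot_le
  lift x i to ℝ using ⟨hxt i, hbot⟩ with xi
  lift x j to ℝ using ⟨hxt j, hj⟩ with xj
  norm_cast
  refine le_of_forall_pos_le_add fun ε hε => ?_
  have := (key (s + ε) (by linarith)).2
  norm_cast at this
  linarith

lemma update_mem_ball (b : Fin n → ℝ) {s : ℝ} (hs : 0 ≤ s) (i : Fin n) :
    ofReal (Function.update b i (b i + s)) ∈ ball (ofReal b) (s : EReal) := by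
  refine ⟨fun _ => EReal.coe_ne_top _, ?_⟩
  rw [hd, if_neg fun h => EReal.coe_ne_bot (b i) (congrFun h.1 i)]
  refine sInf_le ⟨0, -s, by norm_cast; ring, fun j => ?_, fun j => ?_⟩ <;>
  · simp only [ofReal]
    norm_cast
    by_cases hj : j = i
    · subst hj
      simp only [Function.update_self]
      linarith
    · simp only [Function.update_of_ne hj]
      linarith

/-- A real super-eigenvector of `TV V` at level `lam` yields a Hilbert ball of radius `-lam`
inside the column space. -/
lemma ball_subset_colSpace (hVtop : ∀ i k, V i k ≠ ⊤) (hrow : ∀ i, ∃ k, V i k ≠ ⊥)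
    (hcol : ∀ k, ∃ i, V i k ≠ ⊥) {lam : ℝ} {a : Fin n → ℝ}
    (ha : ∀ i, TV V (ofReal a) i ≤ (lam : EReal) + (a i : EReal)) :
    ball (ofReal fun i => -a i) ((-lam : ℝ) : EReal) ⊆ colSpace V := by
  intro x hx
  have hbot : ∀ i, x i ≠ ⊥ := fun i => (ball_spread hx i i).1
  have hspread := fun i j => (ball_spread hx i j).2
  lift x to Fin n → ℝ using fun i => ⟨hx.1 i, hbot i⟩
  have hspread' : ∀ i j, -a i + x j ≤ -lam + -a j + x i := fun i j => by
    have := hspread i j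
    dsimp only at this
    exact_mod_cast this
  let y : Fin p → EReal := fun k => ⨅ j ∈ { j : Fin n | V j k ≠ ⊥ }, ((x j : EReal) - V j k)
  have hVy : ∀ j k, V j k + y k ≤ x j := by
    intro j k
    by_cases hj : V j k = ⊥
    · rw [hj, EReal.bot_add]
      exact bot_le
    · rw [add_comm, ← EReal.le_sub_iff_add_le (Or.inr (EReal.coe_ne_bot _))
        (Or.inr (EReal.coe_ne_top _))]
      exact iInf₂_le j hj
  refine ⟨y, fun k hk => ?_, funext fun i => le_antisymm ?_ (iSup_le fun k => hVy i k)⟩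
  · obtain ⟨j, hj⟩ := hcol k
    have := hVy j k
    rw [hk, EReal.add_top_of_ne_bot hj] at this
    exact absurd this (not_le.2 (EReal.coe_lt_top _))
  · obtain ⟨k, hk, hj⟩ := (TV_le_iff hVtop hrow _ _ _).1 (ha i)
    refine le_trans ?_ (le_iSup _ k)
    have hle : (x i : EReal) - V i k ≤ y k := by
      refine le_iInf₂ fun j hjk => ?_
      change V j k ≠ ⊥ at hjk
      rcases eq_or_ne j i with rfl | hji
      · exact le_rfl
      have h1 := hj j hji
      have h2 := hspread' j i
      simp only [ofReal] at h1
      lift V i k to ℝ using ⟨hVtop i k, hk⟩ with vi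
      lift V j k to ℝ using ⟨hVtop j k, hjk⟩ with vj
      norm_cast at *
      linarith
    calc (x i : EReal) = V i k + ((x i : EReal) - V i k) := by
          lift V i k to ℝ using ⟨hVtop i k, hk⟩ with vi
          norm_cast
          ring
      _ ≤ V i k + y k := by gcongr

/-- The center of a Hilbert ball of radius `s` inside the column space is, up to sign, a real
super-eigenvector of `TV V` at level `-s`. -/
lemma super_of_ball_subset (hVtop : ∀ i k, V i k ≠ ⊤) (hrow : ∀ i, ∃ k, V i k ≠ ⊥)
    {b : Fin n → ℝ} {s : ℝ} (hs : 0 ≤ s) (h : ball (ofReal b) (s : EReal) ⊆ colSpace V)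
    (i : Fin n) :
    TV V (ofReal fun j => -b j) i ≤ ((-s : ℝ) : EReal) + ((-b i : ℝ) : EReal) := by
  obtain ⟨y, hy, hxy⟩ := h (update_mem_ball b hs i)
  obtain ⟨k₀, -⟩ := hrow i
  have : Nonempty (Fin p) := ⟨k₀⟩
  obtain ⟨k, hk⟩ := exists_eq_ciSup_of_finite (f := fun k => V i k + y k)
  have hi := congrFun hxy i
  simp only [ofReal, Function.update_self] at hi
  rw [← hk] at hi
  obtain ⟨hV, hyk⟩ : V i k ≠ ⊥ ∧ y k ≠ ⊥ :=
    EReal.add_ne_bot_iff.1 (hi ▸ EReal.coe_ne_bot _)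
  refine (TV_le_iff hVtop hrow _ _ _).2 ⟨k, hV, fun j hji => ?_⟩
  have hj := congrFun hxy j
  simp only [ofReal, Function.update_of_ne hji] at hj
  have hjk : V j k + y k ≤ (b j : EReal) := hj ▸ le_iSup (fun k => V j k + y k) k
  simp only [ofReal]
  rcases eq_or_ne (V j k) ⊥ with hb | hb
  · rw [hb, EReal.bot_add]
    exact bot_le
  lift V i k to ℝ using ⟨hVtop i k, hV⟩ with vi
  lift V j k to ℝ using ⟨hVtop j k, hb⟩ with vj
  lift y k to ℝ using ⟨hy k, hyk⟩ with yk
  norm_cast at *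
  linarith

lemma exists_super_zero (hVtop : ∀ i k, V i k ≠ ⊤) (hrow : ∀ i, ∃ k, V i k ≠ ⊥) :
    ∃ a : Fin n → ℝ, ∀ i, TV V (ofReal a) i ≤ ((0 : ℝ) : EReal) + (a i : EReal) := by
  have hmax : ∀ i, ∃ k, V i k ≠ ⊥ ∧ ∀ l, V i l ≤ V i k := by
    intro i
    obtain ⟨k₀, hk₀⟩ := hrow i
    have : Nonempty (Fin p) := ⟨k₀⟩
    obtain ⟨k, hk⟩ := Finite.exists_max (V i)
    exact ⟨k, fun h => hk₀ (le_bot_iff.1 (h ▸ hk k₀)), hk⟩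
  choose σ hσ hle using hmax
  choose v hv using fun i => (⟨_, EReal.coe_toReal (hVtop i (σ i)) (hσ i)⟩ :
    ∃ v : ℝ, (v : EReal) = V i (σ i))
  refine ⟨fun i => -v i, fun i => (TV_le_iff hVtop hrow _ _ _).2 ⟨σ i, hσ i, fun j _ => ?_⟩⟩
  have := hle j (σ i)
  rw [← hv] at this ⊢
  calc V j (σ i) + ofReal (fun i => -v i) j ≤ (v j : EReal) + ((-v j : ℝ) : EReal) := by
        gcongr
        rfl
    _ = (v i : EReal) + (((0 : ℝ) : EReal) + ((-v i : ℝ) : EReal)) := by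
        norm_cast
        ring

lemma rho_le_of_super (hVtop : ∀ i k, V i k ≠ ⊤) (hrow : ∀ i, ∃ k, V i k ≠ ⊥)
    {μ : ℝ} {a : Fin n → ℝ} (ha : ∀ i, TV V (ofReal a) i ≤ (μ : EReal) + (a i : EReal)) :
    rho (TV V) ≤ μ :=
  sSup_le fun _ ⟨_, _, hu, hu0, hT⟩ => eigenvalue_le hVtop hrow ha hu hu0 hT

/-- A Collatz–Wielandt alternative: either real super-eigenvectors exist at every level, or the
spectral radius is finite and is itself such a level. -/
lemma super_forall_or_rho (hVtop : ∀ i k, V i k ≠ ⊤) (hrow : ∀ i, ∃ k, V i k ≠ ⊥) :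
    (∀ μ : ℝ, ∃ a : Fin n → ℝ, ∀ i, TV V (ofReal a) i ≤ (μ : EReal) + (a i : EReal)) ∨
    ∃ lam : ℝ, rho (TV V) = lam ∧
      ∃ a : Fin n → ℝ, ∀ i, TV V (ofReal a) i ≤ (lam : EReal) + (a i : EReal) := by
  let M : Set ℝ := { μ | ∃ a : Fin n → ℝ, ∀ i, TV V (ofReal a) i ≤ (μ : EReal) + (a i : EReal) }
  have hup : ∀ μ ∈ M, ∀ ν, μ ≤ ν → ν ∈ M := fun μ ⟨a, ha⟩ ν h =>
    ⟨a, fun i => (ha i).trans (add_le_add (EReal.coe_le_coe_iff.2 h) le_rfl)⟩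
  have hne : M.Nonempty := ⟨0, exists_super_zero hVtop hrow⟩
  by_cases hbdd : BddBelow M
  · right
    obtain ⟨a, ha⟩ : sInf M ∈ M := exists_super_of_forall_pos hVtop hrow fun ε hε => by
      obtain ⟨μ, hμ, hlt⟩ := exists_lt_of_csInf_lt hne (lt_add_of_pos_right (sInf M) hε)
      exact hup μ hμ _ hlt.le
    obtain ⟨u, hu, hu0, hsub⟩ := exists_sub_eigenvector hVtop hrow
      fun μ (hμ : μ < sInf M) (h : μ ∈ M) => hμ.not_ge (csInf_le hbdd h)
    obtain ⟨v, hv, hv0, hT⟩ := exists_eigenvector hVtop hrow ha hu hu0 hsub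
    exact ⟨sInf M, le_antisymm (rho_le_of_super hVtop hrow ha)
      (le_sSup ⟨EReal.coe_ne_top _, v, hv, hv0, hT⟩), a, ha⟩
  · left
    intro μ
    obtain ⟨ν, hν, hlt⟩ := not_bddBelow_iff.1 hbdd μ
    exact hup ν hν μ hlt.le

end Radius

/-- One has `ρ(T) ≤ 0` and `-ρ(T) = inradius(Col(V))`. Moreover, if
`ρ(T)` is finite, then there exists `a ∈ ℝ^n` with `T(a) ≤ ρ(T) + a`, and for any such
`a` the ball `B(-a,-ρ(T))` is a Hilbert ball of maximal radius contained in `Col(V)`. -/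
theorem stmt3 {n p : ℕ} (V : Fin n → Fin p → EReal)
    (hVtop : ∀ i k, V i k ≠ ⊤)
    (hrow : ∀ i, ∃ k, V i k ≠ ⊥) (hcol : ∀ k, ∃ i, V i k ≠ ⊥) :
    rho (TV V) ≤ 0 ∧
    -(rho (TV V)) = inradius (colSpace V) ∧
    (rho (TV V) ≠ ⊥ → rho (TV V) ≠ ⊤ →
      (∃ a : Fin n → ℝ, ∀ i, TV V (ofReal a) i ≤ rho (TV V) + (a i : EReal)) ∧
      ∀ a : Fin n → ℝ, (∀ i, TV V (ofReal a) i ≤ rho (TV V) + (a i : EReal)) →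
        ball (ofReal (fun i => - a i)) (-(rho (TV V))) ⊆ colSpace V ∧
        ∀ (b : Fin n → ℝ) (s : ℝ), 0 ≤ s →
          ball (ofReal b) (s : EReal) ⊆ colSpace V → (s : EReal) ≤ -(rho (TV V))) := by
  have hzero : rho (TV V) ≤ 0 := by
    obtain ⟨a, ha⟩ := exists_super_zero hVtop hrow
    exact_mod_cast rho_le_of_super hVtop hrow ha
  have hmax : ∀ (b : Fin n → ℝ) (s : ℝ), 0 ≤ s →
      ball (ofReal b) (s : EReal) ⊆ colSpace V → (s : EReal) ≤ -(rho (TV V)) := by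
    intro b s hs hball
    have := rho_le_of_super hVtop hrow (super_of_ball_subset hVtop hrow hs hball)
    rw [EReal.le_neg, ← EReal.coe_neg]
    exact this
  have hsup : inradius (colSpace V) ≤ -(rho (TV V)) := by
    refine sSup_le ?_
    rintro _ ⟨s, rfl, hs, b, hb⟩
    exact hmax b s hs hb
  refine ⟨hzero, le_antisymm ?_ hsup, ?_⟩
  · rcases super_forall_or_rho hVtop hrow with hall | ⟨lam, hlam, a, ha⟩
    · suffices inradius (colSpace V) = ⊤ from this ▸ le_top
      refine EReal.eq_top_iff_forall_lt _ |>.2 fun s => ?_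
      obtain ⟨a, ha⟩ := hall (-(|s| + 1))
      have hball := ball_subset_colSpace hVtop hrow hcol ha
      rw [neg_neg] at hball
      refine lt_of_lt_of_le (EReal.coe_lt_coe_iff.2 ?_)
        (le_sSup ⟨|s| + 1, rfl, by positivity, _, hball⟩)
      linarith [le_abs_self s]
    · rw [hlam] at hzero ⊢
      have hlam0 : lam ≤ 0 := by exact_mod_cast hzero
      exact le_sSup ⟨-lam, (EReal.coe_neg lam).symm, by linarith, _,
        ball_subset_colSpace hVtop hrow hcol ha⟩
  · intro hbot htop
    have hcoe : ((rho (TV V)).toReal : EReal) = rho (TV V) := EReal.coe_toReal htop hbot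
    constructor
    · rcases super_forall_or_rho hVtop hrow with hall | ⟨lam, hlam, ha⟩
      · obtain ⟨a, ha⟩ := hall (rho (TV V)).toReal
        exact ⟨a, hcoe ▸ ha⟩
      · rwa [hlam]
    · intro a ha
      refine ⟨?_, hmax⟩
      rw [← hcoe] at ha ⊢
      exact ball_subset_colSpace hVtop hrow hcol ha

end TropReg
end
end

section
/- inradius(Col(V)) = max over all J ⊆ [p] with |J| = n of inradius(Col(V[J])), with the convention that this maximum is 0 when p < n. Moreover, if inradius(Col(V)) > 0, then the maximum is attained by some J such that Col(V[J]) is a simplicial tropical cone. -/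
open scoped Classical BigOperators

noncomputable section

namespace TropReg

/-- Extreme vector of a tropical cone `C`. -/
def IsExtreme {n : ℕ} (C : Set (Fin n → EReal)) (u : Fin n → EReal) : Prop :=
  u ∈ C ∧ ∀ v ∈ C, ∀ w ∈ C, u = (fun i => v i ⊔ w i) → u = v ∨ u = w

/-- Extreme direction of a tropical cone `C`: the set of tropical scalar multiples of
an extreme vector `u ≠ ⊥`. -/
def IsExtremeDir {n : ℕ} (C : Set (Fin n → EReal)) (D : Set (Fin n → EReal)) : Prop :=
  ∃ u : Fin n → EReal, u ≠ ⊥ ∧ IsExtreme C u ∧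
    D = { y | ∃ lam : EReal, lam ≠ ⊤ ∧ y = fun i => lam + u i }

/-- A tropical cone of `(Rmax)^n` is simplicial if it has exactly `n` extreme
directions. -/
def Simplicial {n : ℕ} (C : Set (Fin n → EReal)) : Prop :=
  { D | IsExtremeDir C D }.encard = n

/-- Column space of the submatrix of `V` keeping only the columns in `J`. -/
def colSpaceJ {n p : ℕ} (V : Fin n → Fin p → EReal) (J : Finset (Fin p)) :
    Set (Fin n → EReal) :=
  { y | ∃ x : Fin p → EReal, IsRmax x ∧ y = fun i => ⨆ k ∈ J, (V i k + x k) }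

section

variable {n p : ℕ} {V : Fin n → Fin p → EReal} {J : Finset (Fin p)} {a : Fin n → ℝ} {s : ℝ}

theorem colSpaceJ_univ (V : Fin n → Fin p → EReal) :
    colSpaceJ V Finset.univ = colSpace V := by
  simp [colSpaceJ, colSpace]

theorem colSpaceJ_subset (V : Fin n → Fin p → EReal) (J : Finset (Fin p)) :
    colSpaceJ V J ⊆ colSpace V := by
  rintro y ⟨x, hx, rfl⟩
  refine ⟨fun k => if k ∈ J then x k else ⊥, fun k => ?_, ?_⟩
  · by_cases hk : k ∈ J <;> simp [hk, hx k]
  · funext i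
    refine iSup_congr fun k => ?_
    by_cases hk : k ∈ J <;> simp [hk]

theorem inradius_mono {W W' : Set (Fin n → EReal)} (h : W ⊆ W') : inradius W ≤ inradius W' := by
  refine sSup_le_sSup ?_
  rintro r ⟨s, rfl, hs, a, ha⟩
  exact ⟨s, rfl, hs, a, ha.trans h⟩

theorem le_inradius {W : Set (Fin n → EReal)} (hs : 0 ≤ s)
    (h : ball (ofReal a) s ⊆ W) : (s : EReal) ≤ inradius W :=
  le_sSup ⟨s, rfl, hs, a, h⟩

theorem exists_ball_of_inradius_pos {W : Set (Fin n → EReal)} (h : 0 < inradius W) :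
    ∃ (s : ℝ) (a : Fin n → ℝ), 0 < s ∧ ball (ofReal a) s ⊆ W := by
  obtain ⟨r, ⟨s, rfl, -, a, ha⟩, hr⟩ := lt_sSup_iff.1 h
  exact ⟨s, a, by exact_mod_cast hr, ha⟩

/-- Points of a Hilbert ball with finite center are finite, with oscillation at most the radius. -/
theorem exists_real_of_mem_ball {x : Fin n → EReal} (hx : x ∈ ball (ofReal a) s) :
    ∃ y : Fin n → ℝ, x = ofReal y ∧ ∀ i j, (y i - a i) - (y j - a j) ≤ s := by
  rcases isEmpty_or_nonempty (Fin n) with hn | ⟨⟨i₀⟩⟩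
  · exact ⟨a, funext fun i => hn.elim i, fun i => hn.elim i⟩
  obtain ⟨hx, hd_le⟩ := hx
  have ha : ofReal a ≠ ⊥ := fun h => EReal.coe_ne_bot _ (congrFun h i₀)
  rw [hd, if_neg (fun h => ha h.1)] at hd_le
  have bounds : ∀ ε : ℝ, 0 < ε → ∃ lam mu : ℝ, lam - mu < s + ε ∧
      (∀ i, (mu : EReal) + x i ≤ ofReal a i) ∧ (∀ i, ofReal a i ≤ (lam : EReal) + x i) := by
    intro ε hε
    have hlt : (s : EReal) < ((s + ε : ℝ) : EReal) := by exact_mod_cast lt_add_of_pos_right s hε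
    obtain ⟨t, ⟨lam, mu, rfl, h₁, h₂⟩, ht⟩ := sInf_lt_iff.1 (hd_le.trans_lt hlt)
    exact ⟨lam, mu, by exact_mod_cast ht, h₁, h₂⟩
  have hbot : ∀ i, x i ≠ ⊥ := by
    intro i hi
    obtain ⟨lam, mu, -, -, h⟩ := bounds 1 one_pos
    have := h i
    simp [hi, ofReal] at this
  have hy : ∀ i, x i = ((x i).toReal : EReal) := fun i => (EReal.coe_toReal (hx i) (hbot i)).symm
  refine ⟨fun i => (x i).toReal, funext hy, fun i j => le_of_forall_pos_le_add fun ε hε => ?_⟩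
  obtain ⟨lam, mu, h, h₁, h₂⟩ := bounds ε hε
  have h₁ := h₁ i
  have h₂ := h₂ j
  rw [hy] at h₁ h₂
  simp only [ofReal] at h₁ h₂
  norm_cast at h₁ h₂
  linarith

theorem exists_eq_add_of_mem_colSpaceJ {x : Fin p → EReal} {i : Fin n} {b : ℝ}
    (h : ⨆ k ∈ J, (V i k + x k) = (b : EReal)) : ∃ k ∈ J, V i k + x k = b := by
  rw [← Finset.sup_eq_iSup] at h
  have hJ : J.Nonempty := by
    rw [Finset.nonempty_iff_ne_empty]
    rintro rfl
    simp at h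
  obtain ⟨k, hk, hsup⟩ := Finset.exists_mem_eq_sup J hJ fun k => V i k + x k
  exact ⟨k, hk, hsup ▸ h⟩

theorem exists_coe_of_add_eq_coe {u v : EReal} {b : ℝ} (h : u + v = b) (hu : u ≠ ⊤)
    (hv : v ≠ ⊤) : ∃ u' v' : ℝ, u = u' ∧ v = v' ∧ u' + v' = b := by
  induction u <;> induction v <;> simp_all
  exact_mod_cast h

/-- The column `f i`, shifted by `t i`, reaches `a i + s` at coordinate `i` and is bounded above
by `a` elsewhere. -/
def IsPeak (V : Fin n → Fin p → EReal) (a : Fin n → ℝ) (s : ℝ) (f : Fin n → Fin p)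
    (t : Fin n → ℝ) : Prop :=
  ∀ i, V i (f i) + t i = ((a i + s : ℝ) : EReal) ∧ ∀ j, j ≠ i → V j (f i) + t i ≤ a j

theorem exists_isPeak_of_ball_subset (hVtop : ∀ i k, V i k ≠ ⊤) (hs : 0 < s)
    (h : ball (ofReal a) s ⊆ colSpaceJ V J) :
    ∃ f t, (∀ i, f i ∈ J) ∧ IsPeak V a s f t := by
  suffices ∀ i, ∃ (k : Fin p) (t : ℝ), k ∈ J ∧ V i k + t = ((a i + s : ℝ) : EReal) ∧
      ∀ j, j ≠ i → V j k + t ≤ a j by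
    choose f t hf hft using this
    exact ⟨f, t, hf, hft⟩
  intro i
  have hmem : ofReal (fun j => if j = i then a j + s else a j) ∈ ball (ofReal a) (s : EReal) := by
    refine ⟨fun j => EReal.coe_ne_top _, ?_⟩
    rw [hd, if_neg (fun h => EReal.coe_ne_bot _ (congrFun h.1 i))]
    refine sInf_le ⟨0, -s, by norm_cast; simp, fun j => ?_, fun j => ?_⟩ <;>
    · simp only [ofReal]
      norm_cast
      split_ifs <;> linarith
  obtain ⟨x, hx, hxy⟩ := h hmem
  have hi := congrFun hxy i
  simp only [ofReal, if_true] at hi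
  obtain ⟨k, hk, hki⟩ := exists_eq_add_of_mem_colSpaceJ hi.symm
  obtain ⟨u, t, hu, ht, -⟩ := exists_coe_of_add_eq_coe hki (hVtop i k) (hx k)
  refine ⟨k, t, hk, ht ▸ hki, fun j hj => ?_⟩
  have hj' := congrFun hxy j
  simp only [ofReal, if_neg hj] at hj'
  rw [hj', ← ht]
  exact le_iSup₂ (f := fun k _ => V j k + x k) k hk

namespace IsPeak

variable {f : Fin n → Fin p} {t : Fin n → ℝ}

theorem exists_coe (hP : IsPeak V a s f t) (hVtop : ∀ i k, V i k ≠ ⊤) (i : Fin n) :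
    ∃ v : ℝ, V i (f i) = v ∧ v + t i = a i + s := by
  obtain ⟨u, v, hu, hv, h⟩ := exists_coe_of_add_eq_coe (hP i).1 (hVtop _ _) (EReal.coe_ne_top _)
  exact ⟨u, hu, by rw [EReal.coe_eq_coe_iff.1 hv]; exact h⟩

theorem eq_of_col_eq (hP : IsPeak V a s f t) (hVtop : ∀ i k, V i k ≠ ⊤) (hs : 0 < s)
    {i j : Fin n} {lam : EReal} (hlam : lam ≠ ⊤)
    (h : col V (f i) = fun m => lam + col V (f j) m) : i = j := by
  by_contra hij
  obtain ⟨vi, hvi, hi⟩ := hP.exists_coe hVtop i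
  obtain ⟨vj, hvj, hj⟩ := hP.exists_coe hVtop j
  have hi' : V i (f i) = lam + V i (f j) := congrFun h i
  have hj' : V j (f i) = lam + V j (f j) := congrFun h j
  rw [hvi] at hi'
  obtain ⟨l, u, rfl, hu, hlu⟩ := exists_coe_of_add_eq_coe hi'.symm hlam (hVtop _ _)
  have h₁ := (hP i).2 j (Ne.symm hij)
  have h₂ := (hP j).2 i hij
  rw [hj', hvj] at h₁
  rw [hu] at h₂
  norm_cast at h₁ h₂
  linarith

theorem injective (hP : IsPeak V a s f t) (hVtop : ∀ i k, V i k ≠ ⊤) (hs : 0 < s) :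
    Function.Injective f := fun i j hij =>
  hP.eq_of_col_eq hVtop hs EReal.zero_ne_top (by simp [hij])

theorem ball_subset (hP : IsPeak V a s f t) (hVtop : ∀ i k, V i k ≠ ⊤) (hs : 0 < s) :
    ball (ofReal a) s ⊆ colSpaceJ V (Finset.univ.image f) := by
  intro x hx
  obtain ⟨y, rfl, hy⟩ := exists_real_of_mem_ball hx
  have hf := hP.injective hVtop hs
  let c : Fin n → ℝ := fun i => t i + (y i - a i - s)
  refine ⟨Function.extend f (fun i => (c i : EReal)) ⊥, fun k => ?_, funext fun m => ?_⟩
  · by_cases hk : ∃ i, f i = k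
    · obtain ⟨i, rfl⟩ := hk
      rw [hf.extend_apply]
      exact EReal.coe_ne_top _
    · rw [Function.extend_apply' _ _ _ hk]
      exact bot_ne_top
  · refine le_antisymm ?_ (iSup₂_le fun k hk => ?_)
    · refine le_iSup₂_of_le (f m) (Finset.mem_image_of_mem f (Finset.mem_univ m)) ?_
      obtain ⟨v, hv, hvm⟩ := hP.exists_coe hVtop m
      rw [hf.extend_apply, hv]
      simp only [ofReal, c]
      norm_cast
      linarith
    · obtain ⟨i, -, rfl⟩ := Finset.mem_image.1 hk
      rw [hf.extend_apply]
      rcases eq_or_ne m i with rfl | hmi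
      · obtain ⟨v, hv, hvm⟩ := hP.exists_coe hVtop m
        rw [hv]
        simp only [ofReal, c]
        norm_cast
        linarith
      · have h := (hP i).2 m hmi
        have htop := hVtop m (f i)
        generalize V m (f i) = v at h htop
        induction v with
        | bot => simp
        | top => exact absurd rfl htop
        | coe v =>
          simp only [ofReal, c]
          norm_cast at h ⊢
          linarith [hy i m]

theorem eq_col_of_le (hP : IsPeak V a s f t) (hVtop : ∀ i k, V i k ≠ ⊤) (hs : 0 < s)
    {v : Fin n → EReal} (hv : v ∈ colSpaceJ V (Finset.univ.image f)) {i : Fin n}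
    (hle : v ≤ col V (f i)) (hi : v i = V i (f i)) : col V (f i) = v := by
  obtain ⟨x, hx, rfl⟩ := hv
  obtain ⟨vi, hvi, hti⟩ := hP.exists_coe hVtop i
  obtain ⟨k, hk, hki⟩ := exists_eq_add_of_mem_colSpaceJ (hi.trans hvi)
  obtain ⟨j, -, rfl⟩ := Finset.mem_image.1 hk
  have hge : ∀ m, V m (f j) + x (f j) ≤ ⨆ k ∈ Finset.univ.image f, (V m k + x k) := fun m =>
    le_iSup₂ (f := fun k _ => V m k + x k) (f j) hk
  obtain ⟨u, w, hu, hw, huw⟩ := exists_coe_of_add_eq_coe hki (hVtop _ _) (hx _)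
  rcases eq_or_ne j i with rfl | hji
  · refine le_antisymm (fun m => ?_) hle
    have hw0 : w = 0 := by
      rw [hvi, EReal.coe_eq_coe_iff] at hu
      linarith
    have := hge m
    rwa [hw, hw0, EReal.coe_zero, add_zero] at this
  · exfalso
    obtain ⟨vj, hvj, htj⟩ := hP.exists_coe hVtop j
    have h₁ : V j (f j) + x (f j) ≤ V j (f i) := (hge j).trans (hle j)
    have h₂ := (hP i).2 j hji
    have h₃ := (hP j).2 i hji.symm
    have h₄ := (add_le_add_left h₁ (t i : EReal)).trans h₂
    rw [hvj, hw] at h₄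
    rw [hu] at h₃
    norm_cast at h₃ h₄
    linarith

theorem isExtreme_col (hP : IsPeak V a s f t) (hVtop : ∀ i k, V i k ≠ ⊤) (hs : 0 < s)
    (i : Fin n) : IsExtreme (colSpaceJ V (Finset.univ.image f)) (col V (f i)) := by
  refine ⟨⟨fun k => if k = f i then 0 else ⊥, fun k => ?_, funext fun m => ?_⟩, ?_⟩
  · by_cases hk : k = f i <;> simp [hk]
  · refine le_antisymm ?_ (iSup₂_le fun k _ => ?_)
    · refine le_iSup₂_of_le (f i) (Finset.mem_image_of_mem f (Finset.mem_univ i)) ?_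
      simp [col]
    · by_cases hk : k = f i <;> simp [hk, col]
  · intro v hv w hw h
    have hvle : v ≤ col V (f i) := fun m => h ▸ le_sup_left
    have hwle : w ≤ col V (f i) := fun m => h ▸ le_sup_right
    have hi : V i (f i) = v i ⊔ w i := congrFun h i
    rcases max_choice (v i) (w i) with h' | h'
    · exact Or.inl (hP.eq_col_of_le hVtop hs hv hvle (hi.trans h').symm)
    · exact Or.inr (hP.eq_col_of_le hVtop hs hw hwle (hi.trans h').symm)

end IsPeak

/-- An extreme vector of a column space is a multiple of a column. -/
theorem IsExtreme.exists_col {u : Fin n → EReal} (hu : IsExtreme (colSpaceJ V J) u)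
    (hbot : u ≠ ⊥) : ∃ k ∈ J, ∃ lam : EReal, lam ≠ ⊤ ∧ u = fun i => lam + col V k i := by
  obtain ⟨⟨x, hx, hux⟩, hext⟩ := hu
  have hmem : ∀ K ⊆ J, (fun i => ⨆ k ∈ K, (V i k + x k)) ∈ colSpaceJ V J := by
    intro K hK
    refine ⟨fun k => if k ∈ K then x k else ⊥, fun k => ?_, funext fun i => ?_⟩
    · by_cases hk : k ∈ K <;> simp [hk, hx k]
    · refine le_antisymm (iSup₂_le fun k hk => le_iSup₂_of_le k (hK hk) (by simp [hk]))
        (iSup₂_le fun k _ => ?_)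
      by_cases hk : k ∈ K
      · simpa [hk] using le_iSup₂ (f := fun k _ => V i k + x k) k hk
      · simp [hk]
  suffices ∀ K ⊆ J, (u = fun i => ⨆ k ∈ K, (V i k + x k)) →
      ∃ k ∈ J, ∃ lam : EReal, lam ≠ ⊤ ∧ u = fun i => lam + col V k i from this J subset_rfl hux
  intro K
  induction K using Finset.induction_on with
  | empty =>
    intro _ h
    exact absurd (h.trans (by funext i; simp)) hbot
  | insert k K hk ih =>
    intro hK h
    have hkJ : k ∈ J := hK (Finset.mem_insert_self k K)
    have hKJ : K ⊆ J := (Finset.subset_insert k K).trans hK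
    have hsingle := hmem {k} (Finset.singleton_subset_iff.2 hkJ)
    have hsplit : u = fun i => (⨆ l ∈ ({k} : Finset (Fin p)), (V i l + x l)) ⊔
        ⨆ l ∈ K, (V i l + x l) := by
      rw [h]
      funext i
      rw [Finset.iSup_insert, Finset.iSup_singleton]
    rcases hext _ hsingle _ (hmem K hKJ) hsplit with hsing | hrest
    · refine ⟨k, hkJ, x k, hx k, hsing.trans (funext fun i => ?_)⟩
      rw [Finset.iSup_singleton, add_comm]
      rfl
    · exact ih hKJ hrest

/-- The set of tropical multiples of `u`. -/
def ray (u : Fin n → EReal) : Set (Fin n → EReal) :=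
  { y | ∃ lam : EReal, lam ≠ ⊤ ∧ y = fun i => lam + u i }

theorem self_mem_ray (u : Fin n → EReal) : u ∈ ray u := ⟨0, EReal.zero_ne_top, by simp⟩

theorem ray_coe_add (c : ℝ) (u : Fin n → EReal) : ray (fun i => (c : EReal) + u i) = ray u := by
  ext y
  constructor
  · rintro ⟨lam, hlam, rfl⟩
    exact ⟨lam + c, EReal.add_ne_top hlam (EReal.coe_ne_top c), by simp [add_assoc]⟩
  · rintro ⟨lam, hlam, rfl⟩
    refine ⟨lam + (-c : ℝ), EReal.add_ne_top hlam (EReal.coe_ne_top _), funext fun i => ?_⟩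
    rw [add_assoc, ← add_assoc ((-c : ℝ) : EReal), ← EReal.coe_add]
    simp

theorem IsPeak.simplicial {f : Fin n → Fin p} {t : Fin n → ℝ} (hP : IsPeak V a s f t)
    (hVtop : ∀ i k, V i k ≠ ⊤) (hs : 0 < s) :
    Simplicial (colSpaceJ V (Finset.univ.image f)) := by
  have hrange : { D | IsExtremeDir (colSpaceJ V (Finset.univ.image f)) D } =
      Set.range fun i => ray (col V (f i)) := by
    ext D
    constructor
    · rintro ⟨u, hbot, hu, rfl⟩
      obtain ⟨k, hk, lam, hlam, rfl⟩ := hu.exists_col hbot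
      obtain ⟨i, -, rfl⟩ := Finset.mem_image.1 hk
      refine ⟨i, ?_⟩
      induction lam with
      | bot => exact absurd (by funext m; simp) hbot
      | top => exact absurd rfl hlam
      | coe c => exact (ray_coe_add c _).symm
    · rintro ⟨i, rfl⟩
      refine ⟨col V (f i), fun h => ?_, hP.isExtreme_col hVtop hs i, rfl⟩
      obtain ⟨v, hv, -⟩ := hP.exists_coe hVtop i
      exact EReal.coe_ne_bot v (hv.symm.trans (congrFun h i))
  have hinj : Function.Injective fun i => ray (col V (f i)) := by
    intro i j hij
    have hij : ray (col V (f i)) = ray (col V (f j)) := hij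
    have hmem : col V (f i) ∈ ray (col V (f j)) := hij ▸ self_mem_ray (col V (f i))
    obtain ⟨lam, hlam, h⟩ := hmem
    exact hP.eq_of_col_eq hVtop hs hlam h
  rw [Simplicial, hrange, ← Set.image_univ, hinj.encard_image, Set.encard_univ]
  simp

theorem zero_le_inradius_colSpaceJ (hVtop : ∀ i k, V i k ≠ ⊤)
    (hJ : ∀ i, ∃ k ∈ J, V i k ≠ ⊥) : 0 ≤ inradius (colSpaceJ V J) := by
  have hreal : ∀ i, ∃ b : ℝ, ⨆ k ∈ J, V i k = b := by
    intro i
    obtain ⟨k, hk, hki⟩ := hJ i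
    rw [← Finset.sup_eq_iSup]
    obtain ⟨l, -, hl⟩ := Finset.exists_mem_eq_sup J ⟨k, hk⟩ (V i)
    have hbot : V i l ≠ ⊥ := fun h => hki (le_bot_iff.1 (h ▸ hl ▸ Finset.le_sup (f := V i) hk))
    exact ⟨(V i l).toReal, by rw [hl, EReal.coe_toReal (hVtop i l) hbot]⟩
  choose b hb using hreal
  refine le_inradius (s := 0) (a := b) le_rfl fun x hx => ?_
  obtain ⟨y, rfl, hy⟩ := exists_real_of_mem_ball hx
  rcases isEmpty_or_nonempty (Fin n) with hn | ⟨⟨i₀⟩⟩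
  · exact ⟨0, fun _ => EReal.zero_ne_top, funext fun i => hn.elim i⟩
  refine ⟨fun _ => ((y i₀ - b i₀ : ℝ) : EReal), fun _ => EReal.coe_ne_top _, funext fun i => ?_⟩
  have hyi : y i = b i + (y i₀ - b i₀) := by linarith [hy i i₀, hy i₀ i]
  obtain ⟨k, hk, hki⟩ := exists_eq_add_of_mem_colSpaceJ (x := 0) (J := J) (i := i)
    (by simpa using hb i)
  rw [Pi.zero_apply, add_zero] at hki
  refine le_antisymm (le_iSup₂_of_le k hk ?_) (iSup₂_le fun l hl => ?_)
  · rw [ofReal, hyi, hki, EReal.coe_add]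
  · rw [ofReal, hyi, EReal.coe_add]
    exact add_le_add_left (hb i ▸ le_iSup₂ (f := fun k _ => V i k) l hl) _

theorem inradius_colSpace_of_lt (hVtop : ∀ i k, V i k ≠ ⊤) (hrow : ∀ i, ∃ k, V i k ≠ ⊥)
    (hpn : p < n) : inradius (colSpace V) = 0 := by
  rw [← colSpaceJ_univ]
  refine le_antisymm (not_lt.1 fun hpos => ?_) (zero_le_inradius_colSpaceJ hVtop (by simpa))
  obtain ⟨s, a, hs, h⟩ := exists_ball_of_inradius_pos hpos
  obtain ⟨f, t, -, hP⟩ := exists_isPeak_of_ball_subset hVtop hs h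
  have := Fintype.card_le_of_injective f (hP.injective hVtop hs)
  simp only [Fintype.card_fin] at this
  omega

theorem inradius_colSpace_eq_iSup (hVtop : ∀ i k, V i k ≠ ⊤) (hrow : ∀ i, ∃ k, V i k ≠ ⊥)
    (hnp : n ≤ p) : inradius (colSpace V) =
      ⨆ J ∈ { J : Finset (Fin p) | J.card = n }, inradius (colSpaceJ V J) := by
  refine le_antisymm (sSup_le ?_) (iSup₂_le fun J _ => inradius_mono (colSpaceJ_subset V J))
  rintro r ⟨s, rfl, hs, a, h⟩
  rcases hs.eq_or_lt with rfl | hs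
  · choose g hg using hrow
    obtain ⟨J, hgJ, hJ⟩ := Finset.exists_superset_card_eq (s := Finset.univ.image g) (n := n)
      (Finset.card_image_le.trans (by simp)) (by simpa)
    refine le_iSup₂_of_le J hJ (zero_le_inradius_colSpaceJ hVtop fun i => ⟨g i, hgJ ?_, hg i⟩)
    exact Finset.mem_image_of_mem g (Finset.mem_univ i)
  · rw [← colSpaceJ_univ] at h
    obtain ⟨f, t, -, hP⟩ := exists_isPeak_of_ball_subset hVtop hs h
    refine le_iSup₂_of_le (Finset.univ.image f) ?_ (le_inradius hs.le (hP.ball_subset hVtop hs))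
    simp [Finset.card_image_of_injective _ (hP.injective hVtop hs)]

theorem simplicial_of_inradius_pos (hVtop : ∀ i k, V i k ≠ ⊤) (hJ : J.card = n)
    (hpos : 0 < inradius (colSpaceJ V J)) : Simplicial (colSpaceJ V J) := by
  obtain ⟨s, a, hs, h⟩ := exists_ball_of_inradius_pos hpos
  obtain ⟨f, t, hf, hP⟩ := exists_isPeak_of_ball_subset hVtop hs h
  have himage : Finset.univ.image f = J := by
    refine Finset.eq_of_subset_of_card_le (Finset.image_subset_iff.2 fun i _ => hf i) ?_
    simp [Finset.card_image_of_injective _ (hP.injective hVtop hs), hJ]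
  exact himage ▸ hP.simplicial hVtop hs

end

/-- `inradius(Col(V))` equals the maximum, over all `J ⊆ [p]` with
`|J| = n`, of `inradius(Col(V[J]))` (by convention, `0` when `p < n`); and if
`inradius(Col(V)) > 0` the maximum is attained by some `J` such that `Col(V[J])` is a
simplicial tropical cone. -/
theorem stmt7 {n p : ℕ} (V : Fin n → Fin p → EReal)
    (hVtop : ∀ i k, V i k ≠ ⊤)
    (hrow : ∀ i, ∃ k, V i k ≠ ⊥) (hcol : ∀ k, ∃ i, V i k ≠ ⊥) :
    (p < n → inradius (colSpace V) = 0) ∧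
    (n ≤ p → inradius (colSpace V) =
      ⨆ J ∈ { J : Finset (Fin p) | J.card = n }, inradius (colSpaceJ V J)) ∧
    (0 < inradius (colSpace V) →
      ∃ J : Finset (Fin p), J.card = n ∧
        inradius (colSpaceJ V J) = inradius (colSpace V) ∧
        Simplicial (colSpaceJ V J)) := by
  refine ⟨inradius_colSpace_of_lt hVtop hrow, inradius_colSpace_eq_iSup hVtop hrow, fun hpos => ?_⟩
  have hnp : n ≤ p := not_lt.1 fun h => hpos.ne' (inradius_colSpace_of_lt hVtop hrow h)
  have hne : (Finset.powersetCard n (Finset.univ : Finset (Fin p))).Nonempty :=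
    Finset.powersetCard_nonempty.2 (by simpa)
  obtain ⟨J, hJ, hmax⟩ := Finset.exists_max_image _ (fun J => inradius (colSpaceJ V J)) hne
  have hcard : J.card = n := (Finset.mem_powersetCard.1 hJ).2
  have heq : inradius (colSpaceJ V J) = inradius (colSpace V) := by
    refine le_antisymm (inradius_mono (colSpaceJ_subset V J)) ?_
    rw [inradius_colSpace_eq_iSup hVtop hrow hnp]
    exact iSup₂_le fun K hK =>
      hmax K (Finset.mem_powersetCard.2 ⟨Finset.subset_univ K, hK⟩)
  exact ⟨J, hcard, heq, simplicial_of_inradius_pos hVtop hcard (heq ▸ hpos)⟩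

end TropReg
end
end
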